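/- Let 𝒳 be a finite nonempty set, P_X a pmf on 𝒳, and R_s > 0, R_w > 0. For each n, consider the random-binning ensemble with key set 𝒮_n and helper set 𝒲_n of sizes ⌈e^{nR_s}⌉ and ⌈e^{nR_w}⌉, and define the ensemble-average false-accept probability of the MAP imposter as P̄_FA(n) = E_{f,g}[ ∑_{w∈𝒲_n} max_{s∈𝒮_n} ∑_{x∈𝒳ⁿ : f(x)=w, g(x)=s} ∏_{i=1}^n P_X(x_i) ] (this equals the probability that an imposter who observes W = f(X), X ~ P_X^n, and guesses the key by maximizing the posterior of the key given W, guesses g(X) correctly, averaged over the ensemble). Then limsup_{n→∞} (1/n) ln P̄_FA(n) ≤ −E_FA(R_w, R_s), where E_FA(R_w, R_s) := min over pmfs Q on 𝒳 of [ D(Q‖P_X) + min{ R_s, [H(Q) − R_w]₊ } ]. -/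

import Mathlib

open Filter

/-- A probability mass function on a finite set. -/
def IsPMF {α : Type*} [Fintype α] (Q : α → ℝ) : Prop :=
  (∀ a, 0 ≤ Q a) ∧ ∑ a, Q a = 1

/-- Shannon entropy `H(Q) = −∑ Q a ln Q a` (with `0 ln 0 = 0`, automatic since `ln 0 = 0`). -/
noncomputable def shannonEnt {α : Type*} [Fintype α] (Q : α → ℝ) : ℝ :=
  -∑ a, Q a * Real.log (Q a)

/-- Relative entropy `D(Q‖P) = ∑ Q a ln(Q a / P a)` (finite when `P a = 0 → Q a = 0`). -/
noncomputable def relEnt {α : Type*} [Fintype α] (Q P : α → ℝ) : ℝ :=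
  ∑ a, Q a * Real.log (Q a / P a)

/-- Ensemble-average false-accept probability of the MAP imposter at blocklength `n`:
the average over the random-binning ensemble (encoders `f : 𝒳ⁿ → 𝒲_n`,
`g : 𝒳ⁿ → 𝒮_n` with all bin assignments i.i.d. uniform, `|𝒲_n| = ⌈e^{nR_w}⌉`,
`|𝒮_n| = ⌈e^{nR_s}⌉`) of `∑_w max_s ∑_{x : f x = w, g x = s} ∏ᵢ P (x i)`. -/
noncomputable def PFAbar {X : Type*} [Fintype X] [DecidableEq X]
    (P : X → ℝ) (Rs Rw : ℝ) (n : ℕ) : ℝ :=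
  (∑ f : (Fin n → X) → Fin (Nat.ceil (Real.exp (n * Rw))),
    ∑ g : (Fin n → X) → Fin (Nat.ceil (Real.exp (n * Rs))),
      ∑ w : Fin (Nat.ceil (Real.exp (n * Rw))),
        ⨆ s : Fin (Nat.ceil (Real.exp (n * Rs))),
          ∑ x : Fin n → X, (if f x = w ∧ g x = s then ∏ i, P (x i) else 0)) /
    ((Fintype.card ((Fin n → X) → Fin (Nat.ceil (Real.exp (n * Rw)))) : ℝ) *
      (Fintype.card ((Fin n → X) → Fin (Nat.ceil (Real.exp (n * Rs)))) : ℝ))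


/-- exponential moment of the bin count. -/
lemma fa_expmoment {A W S : Type*} [Fintype A] [DecidableEq A] [Fintype W] [DecidableEq W]
    [Nonempty W] [Fintype S] [DecidableEq S] [Nonempty S] (T : Finset A) (w : W) (s : S) :
    ∑ f : A → W, ∑ g : A → S, Real.exp (∑ x ∈ T, if f x = w ∧ g x = s then (1:ℝ) else 0) ≤
      ((Fintype.card (A → W) : ℝ) * Fintype.card (A → S)) *
        Real.exp (2 * T.card / (Fintype.card W * Fintype.card S)) := by
  set m : ℝ := Fintype.card W * Fintype.card S with hm
  have hmpos : 0 < m := by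
    rw [hm]; exact_mod_cast Nat.mul_pos Fintype.card_pos Fintype.card_pos
  let h : A → W × S → ℝ := fun x p => if x ∈ T ∧ p = (w, s) then Real.exp 1 else 1
  have e1 : ∀ (f : A → W) (g : A → S),
      Real.exp (∑ x ∈ T, if f x = w ∧ g x = s then (1:ℝ) else 0) = ∏ x, h x (f x, g x) := by
    intro f g
    rw [Real.exp_sum, ← Finset.prod_subset (Finset.subset_univ T)]
    · refine Finset.prod_congr rfl fun x hx => ?_
      simp only [h, hx, true_and, Prod.mk.injEq]
      split_ifs <;> simp
    · intro x _ hx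
      simp [h, hx]
  have e2 : ∑ f : A → W, ∑ g : A → S, ∏ x, h x (f x, g x) = ∏ x, ∑ p, h x p := by
    rw [Finset.prod_univ_sum, Fintype.piFinset_univ, ← Fintype.sum_prod_type']
    exact Fintype.sum_equiv (Equiv.arrowProdEquivProdArrow A (fun _ => W) (fun _ => S)).symm _ _ (fun p => rfl)
  have e3 : ∀ x, ∑ p, h x p ≤ m * (if x ∈ T then Real.exp (2 / m) else 1) := by
    intro x
    by_cases hx : x ∈ T
    · simp only [h, hx, true_and, if_true]
      have : ∀ p : W × S, (if p = (w, s) then Real.exp 1 else 1) =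
          1 + if p = (w,s) then Real.exp 1 - 1 else 0 := by
        intro p; split_ifs <;> ring
      simp only [this, Finset.sum_add_distrib]
      simp only [Finset.sum_const, Finset.card_univ, Fintype.card_prod, nsmul_eq_mul, mul_one,
        Finset.sum_ite_eq', Finset.mem_univ, if_true, Nat.cast_mul, ← hm]
      have h1 := Real.add_one_le_exp (2 / m)
      have h2 : m * (2 / m) = 2 := by field_simp
      have h3 := Real.exp_one_lt_d9
      nlinarith
    · simp [h, hx, hm]
  simp only [e1, e2]
  calc ∏ x, ∑ p, h x p ≤ ∏ x : A, m * (if x ∈ T then Real.exp (2 / m) else 1) := by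
        refine Finset.prod_le_prod (fun x _ => Finset.sum_nonneg fun p _ => ?_) (fun x _ => e3 x)
        simp only [h]; split_ifs <;> positivity
    _ = _ := by
        rw [Finset.prod_mul_distrib, Finset.prod_const, Finset.prod_ite_mem]
        simp only [Finset.univ_inter, Finset.prod_const, Finset.card_univ, ← Real.exp_nat_mul]
        rw [hm, mul_pow]
        congr 1
        · simp
        · congr 1; ring

lemma fa_bin {A W S : Type*} [Fintype A] [DecidableEq A] [Fintype W] [DecidableEq W]
    [Nonempty W] [Fintype S] [DecidableEq S] [Nonempty S] (T : Finset A) :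
    ∑ f : A → W, ∑ g : A → S, ∑ w : W, ⨆ s : S, ∑ x ∈ T, (if f x = w ∧ g x = s then (1:ℝ) else 0) ≤
      ((Fintype.card (A → W) : ℝ) * Fintype.card (A → S)) *
        min (T.card : ℝ) (Fintype.card W * (Real.log (Fintype.card S) +
          2 * T.card / (Fintype.card W * Fintype.card S))) := by
  have hW : (0:ℝ) < Fintype.card W := by exact_mod_cast Fintype.card_pos
  have hS : (0:ℝ) < Fintype.card S := by exact_mod_cast Fintype.card_pos
  rw [mul_min_of_nonneg _ _ (by positivity)]
  refine le_min ?_ ?_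
  · calc _ ≤ ∑ f : A → W, ∑ g : A → S, (T.card : ℝ) := by
          refine Finset.sum_le_sum fun f _ => Finset.sum_le_sum fun g _ => ?_
          calc _ ≤ ∑ w : W, ∑ x ∈ T, (if f x = w then (1:ℝ) else 0) := by
                refine Finset.sum_le_sum fun w _ => ciSup_le fun s => Finset.sum_le_sum fun x _ => ?_
                split_ifs <;> simp_all
            _ = _ := by
                rw [Finset.sum_comm]; simp
      _ = _ := by simp; ring
  · set a : ℝ := Fintype.card S * Real.exp (2 * T.card / (Fintype.card W * Fintype.card S)) with ha
    have hapos : 0 < a := by positivity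
    have hla : Real.log a = Real.log (Fintype.card S) +
          2 * T.card / (Fintype.card W * Fintype.card S) := by
      rw [ha, Real.log_mul hS.ne' (Real.exp_ne_zero _), Real.log_exp]
    rw [← hla]
    have key : ∀ (f : A → W) (g : A → S) (w : W),
        ⨆ s : S, ∑ x ∈ T, (if f x = w ∧ g x = s then (1:ℝ) else 0) ≤
          (∑ s : S, Real.exp (∑ x ∈ T, if f x = w ∧ g x = s then (1:ℝ) else 0)) / a
            + (Real.log a - 1) := by
      intro f g w
      refine ciSup_le fun s => ?_
      set N := fun s => ∑ x ∈ T, if f x = w ∧ g x = s then (1:ℝ) else 0 with hN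
      change N s ≤ (∑ s : S, Real.exp (N s)) / a + (Real.log a - 1)
      have h1 : Real.exp (N s) ≤ ∑ s : S, Real.exp (N s) :=
        Finset.single_le_sum (f := fun s => Real.exp (N s)) (fun i _ => (Real.exp_pos _).le) (Finset.mem_univ s)
      have h2 := Real.add_one_le_exp (N s - Real.log a)
      rw [Real.exp_sub, Real.exp_log hapos] at h2
      have h3 : Real.exp (N s) / a ≤ (∑ s : S, Real.exp (N s)) / a := by gcongr
      linarith
    set c : ℝ := (Fintype.card (A → W) : ℝ) * Fintype.card (A → S) with hc
    calc _ ≤ ∑ f : A → W, ∑ g : A → S, ∑ w : W, ((∑ s : S, Real.exp (∑ x ∈ T, if f x = w ∧ g x = s then (1:ℝ) else 0)) / a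
            + (Real.log a - 1)) :=
          Finset.sum_le_sum fun f _ => Finset.sum_le_sum fun g _ => Finset.sum_le_sum fun w _ => key f g w
      _ = ∑ w : W, ((∑ s : S, ∑ f : A → W, ∑ g : A → S, Real.exp (∑ x ∈ T, if f x = w ∧ g x = s then (1:ℝ) else 0)) / a + c * (Real.log a - 1)) := by
          have : ∀ f : A → W, ∑ g : A → S, ∑ w : W, ((∑ s : S, Real.exp (∑ x ∈ T, if f x = w ∧ g x = s then (1:ℝ) else 0)) / a
            + (Real.log a - 1)) = ∑ w : W, ∑ g : A → S, ((∑ s : S, Real.exp (∑ x ∈ T, if f x = w ∧ g x = s then (1:ℝ) else 0)) / a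
            + (Real.log a - 1)) := fun f => Finset.sum_comm
          simp only [this]
          rw [Finset.sum_comm]
          refine Finset.sum_congr rfl fun w _ => ?_
          simp only [Finset.sum_add_distrib, ← Finset.sum_div]
          congr 1
          · congr 1
            rw [Finset.sum_comm]
            rw [Finset.sum_comm]
            conv_rhs => rw [Finset.sum_comm]
            exact Finset.sum_congr rfl fun f _ => Finset.sum_comm
          · simp [hc]; ring
      _ ≤ ∑ w : W, ((∑ s : S, c * Real.exp (2 * T.card / (Fintype.card W * Fintype.card S))) / a + c * (Real.log a - 1)) := by
          gcongr
          exact fa_expmoment T _ _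
      _ = _ := by
          simp only [Finset.sum_const, Finset.card_univ, nsmul_eq_mul]
          have : (Fintype.card S * (c * Real.exp (2 * T.card / (Fintype.card W * Fintype.card S)))) / a = c := by
            rw [div_eq_iff hapos.ne', ha]; ring
          rw [this]; ring

lemma fa_types {A W S ι : Type*} [Fintype A] [DecidableEq A] [Fintype W] [DecidableEq W]
    [Nonempty W] [Fintype S] [DecidableEq S] [Nonempty S] [Fintype ι] [DecidableEq ι]
    (p : A → ℝ) (t : A → ι) (q : ι → ℝ) (hq : ∀ i, 0 ≤ q i) (hpq : ∀ x, p x = q (t x)) :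
    (∑ f : A → W, ∑ g : A → S, ∑ w : W, ⨆ s : S, ∑ x, (if f x = w ∧ g x = s then p x else 0)) /
      ((Fintype.card (A → W) : ℝ) * Fintype.card (A → S)) ≤
      ∑ i, q i * min ((Finset.univ.filter (fun x => t x = i)).card : ℝ)
        (Fintype.card W * (Real.log (Fintype.card S) +
          2 * (Finset.univ.filter (fun x => t x = i)).card / (Fintype.card W * Fintype.card S))) := by
  have hW : (0:ℝ) < Fintype.card (A → W) := by exact_mod_cast Fintype.card_pos
  have hS : (0:ℝ) < Fintype.card (A → S) := by exact_mod_cast Fintype.card_pos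
  rw [div_le_iff₀ (by positivity), Finset.sum_mul]
  have key : ∀ (f : A → W) (g : A → S) (w : W),
      ⨆ s : S, ∑ x, (if f x = w ∧ g x = s then p x else 0) ≤
      ∑ i, q i * ⨆ s : S, ∑ x ∈ Finset.univ.filter (fun x => t x = i), (if f x = w ∧ g x = s then (1:ℝ) else 0) := by
    intro f g w
    refine ciSup_le fun s => ?_
    rw [← Finset.sum_fiberwise (g := t)]
    refine Finset.sum_le_sum fun i _ => ?_
    calc _ = q i * ∑ x ∈ Finset.univ.filter (fun x => t x = i), (if f x = w ∧ g x = s then (1:ℝ) else 0) := by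
          rw [Finset.mul_sum]
          refine Finset.sum_congr rfl fun x hx => ?_
          simp only [Finset.mem_filter, Finset.mem_univ, true_and] at hx
          rw [hpq, hx]; split_ifs <;> simp
      _ ≤ _ := by
          refine mul_le_mul_of_nonneg_left ?_ (hq i)
          exact le_ciSup (f := fun s => ∑ x ∈ Finset.univ.filter (fun x => t x = i), (if f x = w ∧ g x = s then (1:ℝ) else 0)) (Set.finite_range _).bddAbove s
  calc _ ≤ ∑ f : A → W, ∑ g : A → S, ∑ w : W, ∑ i, q i * ⨆ s : S, ∑ x ∈ Finset.univ.filter (fun x => t x = i), (if f x = w ∧ g x = s then (1:ℝ) else 0) :=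
        Finset.sum_le_sum fun f _ => Finset.sum_le_sum fun g _ => Finset.sum_le_sum fun w _ => key f g w
    _ = ∑ i, q i * ∑ f : A → W, ∑ g : A → S, ∑ w : W, ⨆ s : S, ∑ x ∈ Finset.univ.filter (fun x => t x = i), (if f x = w ∧ g x = s then (1:ℝ) else 0) := by
        simp only [Finset.mul_sum]
        conv_rhs => rw [Finset.sum_comm]
        refine Finset.sum_congr rfl fun f _ => ?_
        conv_rhs => rw [Finset.sum_comm]
        refine Finset.sum_congr rfl fun g _ => ?_
        rw [Finset.sum_comm]
    _ ≤ _ := by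
        refine Finset.sum_le_sum fun i _ => ?_
        rw [mul_assoc, mul_comm (min _ _)]
        exact mul_le_mul_of_nonneg_left (fa_bin _) (hq i)
  
lemma fa_lower {A W S : Type*} [Fintype A] [DecidableEq A] [Fintype W] [DecidableEq W]
    [Nonempty W] [Fintype S] [DecidableEq S] [Nonempty S]
    (p : A → ℝ) (hp : ∑ x, p x = 1) :
    1 / (Fintype.card S : ℝ) ≤ (∑ f : A → W, ∑ g : A → S, ∑ w : W, ⨆ s : S, ∑ x, (if f x = w ∧ g x = s then p x else 0)) /
      ((Fintype.card (A → W) : ℝ) * Fintype.card (A → S)) := by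
  have hW : (0:ℝ) < Fintype.card (A → W) := by exact_mod_cast Fintype.card_pos
  have hS : (0:ℝ) < Fintype.card (A → S) := by exact_mod_cast Fintype.card_pos
  have hS' : (0:ℝ) < Fintype.card S := by exact_mod_cast Fintype.card_pos
  rw [le_div_iff₀ (by positivity)]
  calc _ = ∑ f : A → W, ∑ g : A → S, 1 / (Fintype.card S : ℝ) := by simp; ring
    _ ≤ _ := by
      refine Finset.sum_le_sum fun f _ => Finset.sum_le_sum fun g _ => ?_
      rw [div_le_iff₀ hS', Finset.sum_mul]
      calc 1 = ∑ w : W, ∑ s : S, ∑ x, (if f x = w ∧ g x = s then p x else 0) := by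
            rw [← Fintype.sum_prod_type' (f := fun w s => ∑ x, (if f x = w ∧ g x = s then p x else 0)), Finset.sum_comm, ← hp]
            refine Finset.sum_congr rfl fun x _ => ?_
            rw [Finset.sum_eq_single (f x, g x)]
            · simp
            · rintro ⟨w, s⟩ _ h
              rw [if_neg]; rintro ⟨rfl, rfl⟩; exact h rfl
            · simp
        _ ≤ _ := by
            refine Finset.sum_le_sum fun w _ => ?_
            calc _ ≤ ∑ s : S, ⨆ s : S, ∑ x, (if f x = w ∧ g x = s then p x else 0) :=
                  Finset.sum_le_sum fun s _ => le_ciSup (f := fun s => ∑ x, (if f x = w ∧ g x = s then p x else 0)) (Set.finite_range _).bddAbove s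
              _ = _ := by simp; ring


def faSet {X : Type*} [Fintype X] (P : X → ℝ) (Rs Rw : ℝ) : Set ℝ :=
  {v : ℝ | ∃ Q : X → ℝ, IsPMF Q ∧ (∀ x, P x = 0 → Q x = 0) ∧
          v = relEnt Q P + min Rs (max (shannonEnt Q - Rw) 0)}

lemma fa_relEnt_eq {X : Type*} [Fintype X] (Q P : X → ℝ) (h : ∀ x, P x = 0 → Q x = 0) :
    relEnt Q P = -shannonEnt Q - ∑ a, Q a * Real.log (P a) := by
  unfold relEnt shannonEnt
  rw [neg_neg, ← Finset.sum_sub_distrib]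
  refine Finset.sum_congr rfl fun a _ => ?_
  by_cases hq : Q a = 0
  · simp [hq]
  · rw [Real.log_div hq (fun hp => hq (h a hp))]; ring

lemma fa_bdd {X : Type*} [Fintype X] (P : X → ℝ) (hP : IsPMF P) (Rs Rw : ℝ) (hRs : 0 < Rs) :
    BddBelow (faSet P Rs Rw) := by
  refine ⟨-Fintype.card X, ?_⟩
  rintro v ⟨Q, hQ, hac, rfl⟩
  have h1 : 0 ≤ min Rs (max (shannonEnt Q - Rw) 0) := le_min hRs.le (le_max_right _ _)
  have hP1 : ∀ a, P a ≤ 1 := fun a => by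
    rw [← hP.2]; exact Finset.single_le_sum (fun i _ => hP.1 i) (Finset.mem_univ a)
  have h2 : -(Fintype.card X : ℝ) ≤ relEnt Q P := by
    rw [fa_relEnt_eq Q P hac, shannonEnt, neg_neg, ← Finset.sum_sub_distrib]
    calc -(Fintype.card X : ℝ) = ∑ a : X, (-1 : ℝ) := by simp
      _ ≤ _ := by
        refine Finset.sum_le_sum fun a _ => ?_
        have h3 : Q a * Real.log (P a) ≤ 0 :=
          mul_nonpos_of_nonneg_of_nonpos (hQ.1 a) (Real.log_nonpos (hP.1 a) (hP1 a))
        have h4 : -1 ≤ Q a * Real.log (Q a) := by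
          rcases (hQ.1 a).eq_or_lt with h | h
          · simp [← h]
          · have := Real.one_sub_inv_le_log_of_pos h
            have h5 : Q a * (1 - (Q a)⁻¹) = Q a - 1 := by field_simp
            nlinarith
        linarith
  linarith

lemma fa_num (n : ℕ) (D H Rs Rw q T W S E : ℝ) (hRs : 0 < Rs)
    (hq : q = Real.exp (-(n * (D + H)))) (hT0 : 0 ≤ T) (hT : T ≤ Real.exp (n * H))
    (hW0 : 0 < W) (hW : W ≤ 2 * Real.exp (n * Rw)) (hS : Real.exp (n * Rs) ≤ S)
    (hS2 : Real.log S ≤ n * Rs + 1)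
    (hE : E ≤ D + min Rs (max (H - Rw) 0)) :
    q * min T (W * (Real.log S + 2 * T / (W * S))) ≤ (2 * Rs + 4) * (n + 1) * Real.exp (-(n * E)) := by
  have hq0 : 0 < q := hq ▸ Real.exp_pos _
  have hn : (0:ℝ) ≤ n := Nat.cast_nonneg n
  have hSpos : 0 < S := (Real.exp_pos _).trans_le hS
  have hqT : q * T ≤ Real.exp (-(n * D)) := by
    calc q * T ≤ q * Real.exp (n * H) := by gcongr
      _ = _ := by rw [hq, ← Real.exp_add]; congr 1; ring
  have hC : (2 * n * Rs + 4) ≤ (2 * Rs + 4) * (n + 1) := by nlinarith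
  have main : q * min T (W * (Real.log S + 2 * T / (W * S))) ≤ (2 * n * Rs + 4) * Real.exp (-(n * E)) := by
    rcases le_total H Rw with h | h
    · rw [max_eq_right (by linarith), min_eq_right hRs.le] at hE
      calc _ ≤ q * T := by gcongr; exact min_le_left _ _
        _ ≤ 1 * Real.exp (-(n * E)) := by
          rw [one_mul]; refine hqT.trans (Real.exp_le_exp.2 ?_); nlinarith
        _ ≤ _ := by gcongr; nlinarith [mul_nonneg hn hRs.le]
    · rw [max_eq_left (by linarith)] at hE
      have hE1 : E ≤ D + Rs := hE.trans (by gcongr; exact min_le_left _ _)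
      have hE2 : E ≤ D + (H - Rw) := hE.trans (by gcongr; exact min_le_right _ _)
      have hqW : q * W ≤ 2 * Real.exp (-(n * E)) := by
        calc q * W ≤ q * (2 * Real.exp (n * Rw)) := by gcongr
          _ = 2 * Real.exp (-(n * (D + (H - Rw)))) := by
            rw [hq, mul_left_comm, ← Real.exp_add]; congr 2; ring
          _ ≤ _ := by gcongr
      have hqS : q * T / S ≤ Real.exp (-(n * E)) := by
        calc q * T / S ≤ Real.exp (-(n * D)) / Real.exp (n * Rs) := by gcongr
          _ = Real.exp (-(n * (D + Rs))) := by rw [← Real.exp_sub]; congr 1; ring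
          _ ≤ _ := by gcongr
      calc _ ≤ q * (W * (Real.log S + 2 * T / (W * S))) := by gcongr; exact min_le_right _ _
        _ = q * W * Real.log S + 2 * (q * T / S) := by field_simp
        _ ≤ q * W * (n * Rs + 1) + 2 * (q * T / S) := by gcongr
        _ ≤ 2 * Real.exp (-(n * E)) * (n * Rs + 1) + 2 * Real.exp (-(n * E)) := by gcongr
        _ = _ := by ring
  exact main.trans (by gcongr)

/-- The type (vector of counts) of a sequence. -/
def faType {X : Type*} [DecidableEq X] {n : ℕ} (x : Fin n → X) : X → Fin (n + 1) :=
  fun a => ⟨(Finset.univ.filter (fun i => x i = a)).card,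
    Nat.lt_succ_of_le ((Finset.card_le_univ _).trans (by simp))⟩

lemma fa_prod {X : Type*} [Fintype X] [DecidableEq X] {n : ℕ} (P : X → ℝ) (x : Fin n → X) :
    ∏ i, P (x i) = ∏ a, P a ^ (faType x a : ℕ) := by
  rw [← Finset.prod_fiberwise (g := x)]
  refine Finset.prod_congr rfl fun a _ => ?_
  rw [Finset.prod_congr rfl (g := fun _ => P a)]
  · simp [faType]
  · intro i hi; simp at hi; rw [hi]

lemma fa_exp {X : Type*} [Fintype X] (P : X → ℝ) (hP : ∀ a, 0 ≤ P a) (k : X → ℕ)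
    (h : ∀ a, P a = 0 → k a = 0) :
    ∏ a, P a ^ (k a) = Real.exp (∑ a, k a * Real.log (P a)) := by
  rw [Real.exp_sum]
  refine Finset.prod_congr rfl fun a _ => ?_
  by_cases hp : P a = 0
  · simp [h a hp]
  · rw [Real.exp_nat_mul, Real.exp_log (lt_of_le_of_ne (hP a) (Ne.symm hp))]

lemma fa_ceil (y : ℝ) (hy : 1 ≤ y) : ((⌈y⌉₊ : ℕ) : ℝ) ≤ 2 * y := by
  have := Nat.ceil_lt_add_one (show 0 ≤ y by linarith)
  linarith

lemma fa_logceil (n : ℕ) (R : ℝ) (hR : 0 < R) :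
    Real.log ((⌈Real.exp (n * R)⌉₊ : ℕ) : ℝ) ≤ n * R + 1 := by
  have h0 : 0 < ((⌈Real.exp (n * R)⌉₊ : ℕ) : ℝ) := by
    exact_mod_cast Nat.ceil_pos.2 (Real.exp_pos _)
  rw [Real.log_le_iff_le_exp h0, Real.exp_add]
  have := fa_ceil (Real.exp (n * R)) (Real.one_le_exp (by positivity))
  have h2 := Real.add_one_le_exp (1:ℝ)
  nlinarith [Real.exp_pos (n * R)]

lemma fa_upper {X : Type*} [Fintype X] [DecidableEq X]
    (P : X → ℝ) (hP : IsPMF P) (Rs Rw : ℝ) (hRs : 0 < Rs) (hRw : 0 < Rw) (n : ℕ) (hn : 0 < n) :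
    PFAbar P Rs Rw n ≤ ((n:ℝ) + 1) ^ (Fintype.card X) *
      ((2 * Rs + 4) * (n + 1) * Real.exp (-(n * sInf (faSet P Rs Rw)))) := by
  have hn0 : (0:ℝ) < n := by exact_mod_cast hn
  have : NeZero (⌈Real.exp (n * Rw)⌉₊) := ⟨(Nat.ceil_pos.2 (Real.exp_pos _)).ne'⟩
  have : NeZero (⌈Real.exp (n * Rs)⌉₊) := ⟨(Nat.ceil_pos.2 (Real.exp_pos _)).ne'⟩
  unfold PFAbar
  refine (fa_types (fun x : Fin n → X => ∏ i, P (x i)) faType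
    (fun τ => ∏ a, P a ^ (τ a : ℕ)) (fun τ => Finset.prod_nonneg fun a _ => pow_nonneg (hP.1 a) _)
    (fun x => fa_prod P x)).trans ?_
  have hcard : ((n:ℝ) + 1) ^ (Fintype.card X) *
      ((2 * Rs + 4) * (n + 1) * Real.exp (-(n * sInf (faSet P Rs Rw)))) =
      ∑ τ : X → Fin (n + 1), ((2 * Rs + 4) * (n + 1) * Real.exp (-(n * sInf (faSet P Rs Rw)))) := by
    simp
  rw [hcard]
  refine Finset.sum_le_sum fun τ _ => ?_
  set T := Finset.univ.filter (fun x : Fin n → X => faType x = τ) with hT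
  have hRHS : 0 ≤ (2 * Rs + 4) * (n + 1) * Real.exp (-(n * sInf (faSet P Rs Rw))) := by positivity
  have hq0 : 0 ≤ ∏ a, P a ^ (τ a : ℕ) := Finset.prod_nonneg fun a _ => pow_nonneg (hP.1 a) _
  rcases T.eq_empty_or_nonempty with hTe | ⟨x, hx⟩
  · refine le_trans ?_ hRHS
    refine mul_nonpos_of_nonneg_of_nonpos hq0 ((min_le_left _ _).trans ?_)
    simp [hTe]
  by_cases hz : ∏ a, P a ^ (τ a : ℕ) = 0
  · rw [hz, zero_mul]; exact hRHS
  have hac : ∀ a, P a = 0 → (τ a : ℕ) = 0 := by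
    intro a ha
    by_contra hne
    exact hz (Finset.prod_eq_zero (Finset.mem_univ a) (by rw [ha]; exact zero_pow hne))
  have hsum : ∑ a, ((τ a : ℕ) : ℝ) = n := by
    have hxτ : faType x = τ := by simpa [hT] using hx
    rw [← hxτ]
    have := Finset.card_eq_sum_card_fiberwise (f := x) (s := Finset.univ) (t := Finset.univ) (by simp)
    simp only [Finset.card_univ, Fintype.card_fin] at this
    simp only [faType]
    rw [← Nat.cast_sum, ← this]
  set Q : X → ℝ := fun a => ((τ a : ℕ) : ℝ) / n with hQ
  have hnQ : ∀ a, n * Q a = ((τ a : ℕ) : ℝ) := fun a => by simp only [hQ]; field_simp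
  have hQpmf : IsPMF Q := ⟨fun a => by positivity, by
    simp only [hQ]; rw [← Finset.sum_div, hsum, div_self hn0.ne']⟩
  have hQac : ∀ a, P a = 0 → Q a = 0 := fun a ha => by simp [hQ, hac a ha]
  have hmem : relEnt Q P + min Rs (max (shannonEnt Q - Rw) 0) ∈ faSet P Rs Rw :=
    ⟨Q, hQpmf, hQac, rfl⟩
  have hTle : (T.card : ℝ) ≤ Real.exp (n * shannonEnt Q) := by
    have h1 : ∑ x : Fin n → X, ∏ i, Q (x i) = 1 := by
      rw [← Fintype.piFinset_univ, ← Finset.prod_univ_sum (fun _ => Finset.univ) (fun _ a => Q a)]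
      simp [hQpmf.2]
    have h2 : ∏ a, Q a ^ (τ a : ℕ) = Real.exp (-(n * shannonEnt Q)) := by
      rw [fa_exp Q hQpmf.1]
      · congr 1
        rw [shannonEnt, mul_neg, neg_neg, Finset.mul_sum]
        refine Finset.sum_congr rfl fun a _ => ?_
        rw [← hnQ a]; ring
      · intro a ha
        have := hnQ a
        rw [ha, mul_zero] at this
        exact_mod_cast this.symm
    have h3 : (T.card : ℝ) * Real.exp (-(n * shannonEnt Q)) ≤ 1 := by
      rw [← h1, ← nsmul_eq_mul, ← Finset.sum_const]
      calc _ = ∑ x ∈ T, ∏ i, Q (x i) := by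
            refine Finset.sum_congr rfl fun y hy => ?_
            have : faType y = τ := by simpa [hT] using hy
            rw [fa_prod, this, h2]
        _ ≤ _ := Finset.sum_le_sum_of_subset_of_nonneg (Finset.subset_univ _)
            fun y _ _ => Finset.prod_nonneg fun i _ => hQpmf.1 _
    rw [Real.exp_neg, ← div_eq_mul_inv, div_le_one (Real.exp_pos _)] at h3
    exact h3
  refine fa_num n (relEnt Q P) (shannonEnt Q) Rs Rw _ _ _ _ _ hRs ?_ (Nat.cast_nonneg _) hTle ?_ ?_ ?_ ?_
    (csInf_le (fa_bdd P hP Rs Rw hRs) hmem)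
  · rw [fa_exp P hP.1 _ hac, fa_relEnt_eq Q P hQac]
    congr 1
    have : n * ∑ a, Q a * Real.log (P a) = ∑ a, ((τ a : ℕ) : ℝ) * Real.log (P a) := by
      rw [Finset.mul_sum]
      refine Finset.sum_congr rfl fun a _ => ?_
      rw [← hnQ a]; ring
    rw [← this]; ring
  · exact_mod_cast Fintype.card_pos
  · rw [Fintype.card_fin]; exact fa_ceil _ (Real.one_le_exp (by positivity))
  · rw [Fintype.card_fin]; exact Nat.le_ceil _
  · rw [Fintype.card_fin]; exact fa_logceil n Rs hRs

lemma fa_lower' {X : Type*} [Fintype X] [DecidableEq X]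
    (P : X → ℝ) (hP : IsPMF P) (Rs Rw : ℝ) (n : ℕ) :
    1 / ((⌈Real.exp (n * Rs)⌉₊ : ℕ) : ℝ) ≤ PFAbar P Rs Rw n := by
  have : NeZero (⌈Real.exp (n * Rw)⌉₊) := ⟨(Nat.ceil_pos.2 (Real.exp_pos _)).ne'⟩
  have : NeZero (⌈Real.exp (n * Rs)⌉₊) := ⟨(Nat.ceil_pos.2 (Real.exp_pos _)).ne'⟩
  unfold PFAbar
  have h1 : ∑ x : Fin n → X, ∏ i, P (x i) = 1 := by
    rw [← Fintype.piFinset_univ, ← Finset.prod_univ_sum (fun _ => Finset.univ) (fun _ a => P a)]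
    simp [hP.2]
  have := fa_lower (W := Fin ⌈Real.exp (n * Rw)⌉₊) (S := Fin ⌈Real.exp (n * Rs)⌉₊)
    (fun x : Fin n → X => ∏ i, P (x i)) h1
  rwa [Fintype.card_fin] at this

lemma fa_tendsto (E C : ℝ) (d : ℕ) :
    Tendsto (fun n : ℕ => -E + (C + d * Real.log ((n:ℝ) + 1)) / n) atTop (nhds (-E)) := by
  have h1 : Tendsto (fun n : ℕ => C / (n:ℝ)) atTop (nhds 0) :=
    tendsto_const_div_atTop_nhds_zero_nat C
  have h2 : Tendsto (fun n : ℕ => Real.log ((n:ℝ) + 1) / (n:ℝ)) atTop (nhds 0) := by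
    have h3 : Tendsto (fun y : ℝ => Real.log y / (1 * y + (-1))) atTop (nhds 0) := by
      simpa using Real.tendsto_pow_log_div_mul_add_atTop 1 (-1) 1 one_ne_zero
    have h4 : Tendsto (fun n : ℕ => (n:ℝ) + 1) atTop atTop :=
      tendsto_atTop_add_const_right _ _ tendsto_natCast_atTop_atTop
    refine (h3.comp h4).congr fun n => ?_
    simp
  have h5 := ((h1.add (h2.const_mul (d:ℝ))).const_add (-E))
  simp only [mul_zero, add_zero] at h5
  refine h5.congr fun n => ?_
  ring

/-- Theorem 3 of the paper: the ensemble-average false-accept probability of the MAP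
imposter satisfies `limsup (1/n) ln P̄_FA(n) ≤ −E_FA(R_w, R_s)`, where
`E_FA(R_w, R_s) = min_Q [D(Q‖P) + min{R_s, [H(Q) − R_w]₊}]` (the minimum over pmfs `Q`;
`Q`'s with `D(Q‖P) = +∞`, i.e. not absolutely continuous w.r.t. `P`, do not affect
the minimum and are excluded). -/
theorem false_accept_ensemble_exponent {X : Type*} [Fintype X] [DecidableEq X] [Nonempty X]
    (P : X → ℝ) (hP : IsPMF P) (Rs Rw : ℝ) (hRs : 0 < Rs) (hRw : 0 < Rw) :
    limsup (fun n : ℕ => (1 / (n : ℝ)) * Real.log (PFAbar P Rs Rw n)) atTop ≤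
      -sInf {v : ℝ | ∃ Q : X → ℝ, IsPMF Q ∧ (∀ x, P x = 0 → Q x = 0) ∧
          v = relEnt Q P + min Rs (max (shannonEnt Q - Rw) 0)} := by
  change _ ≤ -sInf (faSet P Rs Rw)
  set E := sInf (faSet P Rs Rw) with hE
  have hpos : ∀ n : ℕ, 0 < 1 / ((⌈Real.exp (n * Rs)⌉₊ : ℕ) : ℝ) := fun n => by
    have : 0 < ((⌈Real.exp (n * Rs)⌉₊ : ℕ) : ℝ) := by
      exact_mod_cast Nat.ceil_pos.2 (Real.exp_pos _)
    positivity
  have hT := fa_tendsto E (Real.log (2 * Rs + 4)) (Fintype.card X + 1)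
  rw [← hT.limsup_eq]
  refine limsup_le_limsup ?_ ?_ hT.isBoundedUnder_le
  · filter_upwards [eventually_gt_atTop 0] with n hn
    have hn0 : (0:ℝ) < n := by exact_mod_cast hn
    have h1 := Real.log_le_log ((hpos n).trans_le (fa_lower' P hP Rs Rw n))
      (fa_upper P hP Rs Rw hRs hRw n hn)
    rw [Real.log_mul (by positivity) (by positivity), Real.log_mul (by positivity) (by positivity),
      Real.log_mul (by positivity) (by positivity), Real.log_exp, Real.log_pow, ← hE] at h1
    calc _ ≤ 1 / (n:ℝ) * _ := mul_le_mul_of_nonneg_left h1 (by positivity)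
      _ = _ := by push_cast; field_simp; ring
  · refine IsBoundedUnder.isCoboundedUnder_le ⟨-(Rs + 1), ?_⟩
    rw [eventually_map]
    filter_upwards [eventually_gt_atTop 0] with n hn
    have hn0 : (1:ℝ) ≤ n := by exact_mod_cast hn
    have h1 := Real.log_le_log (hpos n) (fa_lower' P hP Rs Rw n)
    rw [one_div, Real.log_inv] at h1
    have h2 := fa_logceil n Rs hRs
    rw [one_div, inv_mul_eq_div, le_div_iff₀ (by linarith)]
    nlinarith
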